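/- arXiv:1901.10979 — 6 statements merged into one kernel-verified Lean document; each statement's English description precedes it below -/
import Mathlib

section
/- Let p be a prime, K a finite field of characteristic p, and G = ⟨g⟩ × ⟨h⟩ an elementary abelian group of order p². Then the minimal right ideal C = K·(Σ_{x∈G} x) of KG is not checkable: there is no v ∈ KG with C = {a ∈ KG : va = 0}. -/
lemma aux_rank {K V : Type*} [Field K] [AddCommGroup V] [Module K V] [FiniteDimensional K V]
    (L : V →ₗ[K] V) (h1 : Module.finrank K (LinearMap.ker L) ≤ 1) (k : ℕ) :
    Module.finrank K V ≤ Module.finrank K (LinearMap.range (L ^ k)) + k := by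
  induction k with
  | zero =>
    rw [pow_zero, Module.End.one_eq_id, LinearMap.range_id, finrank_top]
    simp
  | succ k ih =>
    have e : LinearMap.range (L ^ (k + 1)) =
        LinearMap.range (L.domRestrict (LinearMap.range (L ^ k))) := by
      rw [pow_succ', Module.End.mul_eq_comp, LinearMap.range_comp, LinearMap.range_domRestrict]
    have h2 := LinearMap.finrank_range_add_finrank_ker
      (L.domRestrict (LinearMap.range (L ^ k)))
    have h3 : Module.finrank K (LinearMap.ker (L.domRestrict (LinearMap.range (L ^ k)))) ≤
        Module.finrank K (LinearMap.ker L) := by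
      rw [← Submodule.finrank_map_subtype_eq]
      apply Submodule.finrank_mono
      rintro x ⟨y, hy, rfl⟩
      simpa using hy
    rw [e]
    omega

lemma aux_pow (p : ℕ) [Fact p.Prime] {K : Type*} [Field K] [CharP K p]
    {G : Type*} [CommGroup G] (helem : ∀ x : G, x ^ p = 1) (v : MonoidAlgebra K G) :
    ∃ c : K, v ^ p = algebraMap K (MonoidAlgebra K G) c := by
  have : CharP (MonoidAlgebra K G) p := charP_of_injective_algebraMap' K p
  induction v using MonoidAlgebra.induction_linear with
  | zero => exact ⟨0, by simp [(Fact.out : p.Prime).ne_zero]⟩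
  | add a b ha hb =>
    obtain ⟨c, hc⟩ := ha
    obtain ⟨d, hd⟩ := hb
    exact ⟨c + d, by rw [add_pow_char, hc, hd, map_add]⟩
  | single x r =>
    exact ⟨r ^ p, by simp [MonoidAlgebra.single_pow, helem]⟩


/-- let `K` be a finite field of characteristic `p` and `G` an elementary
abelian group of order `p²`. Then the minimal right ideal `C = K·(Σ_{x∈G} x)` of `KG` is
not checkable: there is no `v` with `C = {a | v * a = 0}`. -/
theorem stmt10 (p : ℕ) [Fact p.Prime] (K : Type*) [Field K] [Fintype K] [CharP K p]
    (G : Type*) [CommGroup G] [Fintype G]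
    (helem : ∀ x : G, x ^ p = 1) (hcard : Fintype.card G = p ^ 2) :
    ¬ ∃ v : MonoidAlgebra K G,
        {a : MonoidAlgebra K G | v * a = 0} =
          Set.range (fun c : K => c • ∑ x : G, MonoidAlgebra.single x (1 : K)) := by
  rintro ⟨v, hv⟩
  have hfr : Module.finrank K (MonoidAlgebra K G) = p ^ 2 := by
    rw [(MonoidAlgebra.coeffLinearEquiv (M := G) (S := K) K).finrank_eq,
      Module.finrank_finsupp_self, hcard]
  have hfd : FiniteDimensional K (MonoidAlgebra K G) :=
    Module.Finite.equiv (MonoidAlgebra.coeffLinearEquiv (M := G) (S := K) K).symm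
  have hp := (Fact.out : p.Prime).two_le
  set s : MonoidAlgebra K G := ∑ x : G, MonoidAlgebra.single x (1 : K) with hs
  have hs0 : s ≠ 0 := by
    intro h
    have h2 := congrArg (fun a => a.coeff 1) h
    classical
    simp [hs, Finsupp.single_apply] at h2
  have hvs : v * s = 0 := by
    have : s ∈ {a : MonoidAlgebra K G | v * a = 0} := by
      rw [hv]; exact ⟨1, one_smul _ _⟩
    exact this
  obtain ⟨c, hc⟩ := aux_pow p helem v
  have hvp : v ^ p = 0 := by
    have h0 : v ^ p * s = 0 := by
      obtain ⟨n, rfl⟩ : ∃ n, p = n + 1 := ⟨p - 1, by omega⟩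
      rw [pow_succ, mul_assoc, hvs, mul_zero]
    rw [hc, ← Algebra.smul_def] at h0
    rcases smul_eq_zero.1 h0 with h | h
    · rw [hc, h, map_zero]
    · exact absurd h hs0
  have hk : Module.finrank K (LinearMap.ker (LinearMap.mulLeft K v)) ≤ 1 := by
    have : LinearMap.ker (LinearMap.mulLeft K v) ≤ K ∙ s := by
      intro a ha
      have h : a ∈ {a : MonoidAlgebra K G | v * a = 0} := by simpa using ha
      rw [hv] at h
      exact Submodule.mem_span_singleton.2 h
    exact (Submodule.finrank_mono this).trans (finrank_span_singleton hs0).le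
  have := aux_rank _ hk p
  rw [LinearMap.pow_mulLeft, hvp, LinearMap.mulLeft_zero_eq_zero, LinearMap.range_zero,
    finrank_bot, hfr] at this
  nlinarith
end

section
/- Let T be a finite p-group and K a finite field of characteristic p. The one-dimensional ideal K·(Σ_{t∈T} t) of KT is checkable if and only if T is cyclic. -/
open MonoidAlgebra in
theorem aux_hom (p : ℕ) [Fact p.Prime] (K : Type*) [Field K] [CharP K p]
    (T : Type*) [Group T] [Finite T] (hT : IsPGroup p T) (M : Subgroup T) (hM : IsCoatom M) :
    ∃ f : T → K, (∀ s t, f (s * t) = f s + f t) ∧ ∀ t, f t = 0 ↔ t ∈ M := by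
  have hnil : Group.IsNilpotent T := hT.isNilpotent
  have hnorm : M.Normal := Subgroup.NormalizerCondition.normal_of_coatom M Group.normalizerCondition_of_isNilpotent hM
  have hQ : IsPGroup p (T ⧸ M) := hT.to_quotient M
  have hnt : Nontrivial (T ⧸ M) := QuotientGroup.nontrivial_iff.2 hM.1
  have hdvd : p ∣ Nat.card (T ⧸ M) := hQ.card_eq_or_dvd.resolve_left
    (fun h => (Finite.one_lt_card (α := T ⧸ M)).ne' h)
  obtain ⟨x, hx⟩ := exists_prime_orderOf_dvd_card' p hdvd
  have htop : (Subgroup.zpowers x).comap (QuotientGroup.mk' M) = ⊤ := by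
    apply hM.2
    refine lt_of_le_of_ne ?_ ?_
    · intro t ht
      have : (QuotientGroup.mk' M) t = 1 := (QuotientGroup.eq_one_iff t).2 ht
      rw [Subgroup.mem_comap, this]
      exact one_mem _
    · intro h
      obtain ⟨t, rfl⟩ := QuotientGroup.mk'_surjective M x
      have ht : t ∈ M := by
        rw [h]
        exact Subgroup.mem_zpowers _
      have h1 : (QuotientGroup.mk' M) t = 1 := (QuotientGroup.eq_one_iff t).2 ht
      rw [h1, orderOf_one] at hx
      exact (Fact.out : p.Prime).one_lt.ne hx
  have hgen : ∀ y, y ∈ Subgroup.zpowers x := by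
    intro y
    obtain ⟨t, rfl⟩ := QuotientGroup.mk'_surjective M y
    have : t ∈ (⊤ : Subgroup T) := trivial
    rw [← htop] at this
    exact this
  have hcard : Nat.card (T ⧸ M) = p := by
    rw [← hx]; exact (orderOf_eq_card_of_forall_mem_zpowers hgen).symm
  have hcyc : IsCyclic (T ⧸ M) := ⟨x, hgen⟩
  let e := zmodCyclicMulEquiv hcyc
  have : CharP K (Nat.card (T ⧸ M)) := by rw [hcard]; infer_instance
  have hinj : Function.Injective (ZMod.castHom (dvd_refl (Nat.card (T ⧸ M))) K) := by
    have : Fact (Nat.card (T ⧸ M)).Prime := by rw [hcard]; infer_instance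
    exact RingHom.injective _
  refine ⟨fun t => ZMod.castHom (dvd_refl (Nat.card (T ⧸ M))) K
    (Multiplicative.toAdd (e.symm (t : T ⧸ M))), fun s t => ?_, fun t => ?_⟩
  · beta_reduce
    rw [QuotientGroup.mk_mul, map_mul, toAdd_mul, map_add]
  · beta_reduce
    rw [map_eq_zero_iff _ hinj, toAdd_eq_zero, EmbeddingLike.map_eq_one_iff,
      QuotientGroup.eq_one_iff]

/-- The dual-number representation attached to an additive character. -/
noncomputable def dualRep {K T : Type*} [Field K] [Group T] (f : T → K)
    (hf : ∀ s t, f (s * t) = f s + f t) : T →* DualNumber K where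
  toFun t := TrivSqZeroExt.inl 1 + TrivSqZeroExt.inr (f t)
  map_one' := by
    have : f 1 = 0 := by simpa using hf 1 1
    ext <;> simp [this]
  map_mul' s t := by
    ext
    · simp
    · simp [hf, add_comm]

theorem dualRep_fst {K T : Type*} [Field K] [Group T] (f : T → K)
    (hf : ∀ s t, f (s * t) = f s + f t) (t : T) : (dualRep f hf t).fst = 1 := by
  simp [dualRep]

theorem dualRep_snd {K T : Type*} [Field K] [Group T] (f : T → K)
    (hf : ∀ s t, f (s * t) = f s + f t) (t : T) : (dualRep f hf t).snd = f t := by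
  simp [dualRep]

open MonoidAlgebra in
theorem aug_eq {K T : Type*} [Field K] [Group T] (f : T → K)
    (hf : ∀ s t, f (s * t) = f s + f t) (x : MonoidAlgebra K T) :
    (lift K (DualNumber K) T (dualRep f hf) x).fst = lift K K T 1 x := by
  induction x using MonoidAlgebra.induction_linear with
  | zero => simp
  | add x y hx hy => simp [hx, hy]
  | single m r => simp [dualRep_fst]

open MonoidAlgebra in
theorem mul_sigma {K T : Type*} [Field K] [Group T] [Fintype T] (x : MonoidAlgebra K T) :
    x * ∑ t : T, single t (1 : K) = lift K K T 1 x • ∑ t : T, single t (1 : K) := by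
  induction x using MonoidAlgebra.induction_linear with
  | zero => simp
  | add x y hx hy => rw [add_mul, hx, hy, map_add, add_smul]
  | single m r =>
    rw [Finset.mul_sum, Finset.smul_sum,
      ← Equiv.sum_comp (Equiv.mulLeft m) (fun t => lift K K T 1 (single m r) • single t (1 : K))]
    simp [single_mul_single]

open MonoidAlgebra in
theorem sigma_coeff {K T : Type*} [Field K] [Group T] [Fintype T] (s : T) :
    (∑ t : T, single t (1 : K)).coeff s = 1 := by
  classical
  simp [Finsupp.single_apply]

open MonoidAlgebra in
theorem forward {K T : Type*} [Field K] [Group T] [Fintype T] (v : MonoidAlgebra K T)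
    (hv : {a : MonoidAlgebra K T | v * a = 0} =
          Set.range (fun c : K => c • ∑ t : T, MonoidAlgebra.single t (1 : K))) :
    ∃ c : T → K, ∀ f : T → K, (∀ s t, f (s * t) = f s + f t) → ∃ a, ∀ t, f t = a * c t := by
  set σ : MonoidAlgebra K T := ∑ t : T, single t (1 : K) with hσ
  have hσ0 : σ ≠ 0 := fun h => by
    have := sigma_coeff (K := K) (1 : T)
    rw [← hσ, h] at this
    simp at this
  have hvσ : v * σ = 0 := by
    have : σ ∈ {a : MonoidAlgebra K T | v * a = 0} := by rw [hv]; exact ⟨1, one_smul _ _⟩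
    exact this
  have hε : lift K K T 1 v = 0 := by
    rw [mul_sigma] at hvσ
    exact (smul_eq_zero.1 hvσ).resolve_right hσ0
  have hker : (LinearMap.mulLeft K v).ker = Submodule.span K {σ} := by
    ext a
    rw [LinearMap.mem_ker, LinearMap.mulLeft_apply, Submodule.mem_span_singleton]
    exact Set.ext_iff.1 hv a
  have h1 := LinearMap.finrank_range_add_finrank_ker (LinearMap.mulLeft K v)
  have h2 := LinearMap.finrank_range_add_finrank_ker (lift K K T 1).toLinearMap
  have hsurj : (lift K K T 1).toLinearMap.range = ⊤ := by
    rw [LinearMap.range_eq_top]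
    intro r
    exact ⟨single 1 r, by simp⟩
  rw [hker, finrank_span_singleton hσ0] at h1
  rw [hsurj, finrank_top, Module.finrank_self] at h2
  have heq : (LinearMap.mulLeft K v).range = (lift K K T 1).toLinearMap.ker := by
    apply Submodule.eq_of_le_of_finrank_eq
    · rintro _ ⟨a, rfl⟩
      simp only [LinearMap.mem_ker, LinearMap.mulLeft_apply, AlgHom.toLinearMap_apply, map_mul, hε,
        zero_mul]
    · omega
  have hex : ∀ t : T, ∃ a, v * a = single t (1 : K) - 1 := by
    intro t
    have : single t (1 : K) - 1 ∈ (LinearMap.mulLeft K v).range := by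
      rw [heq]
      simp
    obtain ⟨a, ha⟩ := this
    exact ⟨a, ha⟩
  choose a ha using hex
  refine ⟨fun t => lift K K T 1 (a t), fun f hf =>
    ⟨(lift K (DualNumber K) T (dualRep f hf) v).snd, fun t => ?_⟩⟩
  have h3 := congrArg (fun x => (lift K (DualNumber K) T (dualRep f hf) x).snd) (ha t)
  simp only [map_mul, TrivSqZeroExt.snd_mul, aug_eq, hε, map_sub, map_one, lift_single] at h3
  simp [dualRep_snd] at h3
  rw [← h3]

open MonoidAlgebra in
theorem backward {K T : Type*} [Field K] [Group T] [Fintype T] (h : IsCyclic T) :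
    ∃ v : MonoidAlgebra K T,
        {a : MonoidAlgebra K T | v * a = 0} =
          Set.range (fun c : K => c • ∑ t : T, MonoidAlgebra.single t (1 : K)) := by
  obtain ⟨g, hg⟩ := h
  refine ⟨single g⁻¹ 1 - 1, Set.ext fun a => ⟨fun ha => ?_, ?_⟩⟩
  · have ha : (single g⁻¹ 1 - 1) * a = 0 := ha
    rw [sub_mul, one_mul, sub_eq_zero] at ha
    have hinv : ∀ t, a.coeff (g * t) = a.coeff t := fun t => by
      have := congrArg (fun x => x.coeff t) ha
      simpa using this
    have hz : ∀ n : ℕ, a.coeff (g ^ n) = a.coeff 1 := by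
      intro n
      induction n with
      | zero => simp
      | succ n ih => rw [pow_succ', hinv, ih]
    refine ⟨a.coeff 1, ?_⟩
    ext t
    obtain ⟨n, rfl⟩ := (mem_powers_iff_mem_zpowers).2 (hg t)
    simp only [coeff_smul, Finsupp.smul_apply, sigma_coeff]
    simp [hz]
  · rintro ⟨c, rfl⟩
    simp only [Set.mem_ofPred_eq]
    rw [mul_smul_comm, mul_sigma]
    simp

/-- for a finite `p`-group `T` and a finite field `K` of characteristic `p`,
the one-dimensional ideal `K·(Σ_{t∈T} t)` of `KT` is checkable iff `T` is cyclic. -/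
theorem stmt11 (p : ℕ) [Fact p.Prime] (K : Type*) [Field K] [Fintype K] [CharP K p]
    (T : Type*) [Group T] [Fintype T] (hT : IsPGroup p T) :
    (∃ v : MonoidAlgebra K T,
        {a : MonoidAlgebra K T | v * a = 0} =
          Set.range (fun c : K => c • ∑ t : T, MonoidAlgebra.single t (1 : K))) ↔
      IsCyclic T := by
  refine ⟨?_, backward⟩
  rintro ⟨v, hv⟩
  obtain ⟨c, hc⟩ := forward v hv
  have key : ∀ M : Subgroup T, IsCoatom M → ∀ t, c t = 0 ↔ t ∈ M := by
    intro M hM t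
    obtain ⟨f, hf, hfM⟩ := aux_hom p K T hT M hM
    obtain ⟨a, ha⟩ := hc f hf
    have ha0 : a ≠ 0 := by
      rintro rfl
      exact hM.1 (eq_top_iff.2 fun t _ => (hfM t).1 (by simp [ha]))
    rw [← hfM, ha, mul_eq_zero, or_iff_right ha0]
  by_cases hz : ∃ g, c g ≠ 0
  · obtain ⟨g, hg⟩ := hz
    refine ⟨g, ?_⟩
    rcases eq_top_or_exists_le_coatom (Subgroup.zpowers g) with h | ⟨M, hM, hle⟩
    · intro x; exact (h ▸ Subgroup.mem_top x : x ∈ Subgroup.zpowers g)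
    · exact absurd ((key M hM g).2 (hle (Subgroup.mem_zpowers g))) hg
  · push Not at hz
    rcases eq_top_or_exists_le_coatom (Subgroup.zpowers (1 : T)) with h | ⟨M, hM, hle⟩
    · refine ⟨1, fun x => ?_⟩
      exact (h ▸ Subgroup.mem_top x : x ∈ Subgroup.zpowers (1 : T))
    · exact absurd (eq_top_iff.2 fun t _ => (key M hM t).1 (hz t)) hM.1
end

section
/- Let G be a finite group and K a finite field. The Jacobson radical J(KG) of the group algebra KG is a checkable ideal: there exists a ∈ KG with J(KG) = {b ∈ KG : ab = 0}. -/
/-- A semisimple algebra over a field is a Frobenius algebra. -/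
theorem semisimple_frobenius (K S : Type*) [Field K] [Ring S] [Algebra K S]
    [IsSemisimpleRing S] :
    ∃ f : S →ₗ[K] K, ∀ b : S, (∀ x, f (b * x) = 0) → b = 0 := by
  classical
  obtain ⟨n, D, d, _, _, hd, ⟨e⟩⟩ := IsSemisimpleRing.exists_algEquiv_pi_matrix_divisionRing K S
  have hg : ∀ i, ∃ g : D i →ₗ[K] K, g 1 ≠ 0 := fun i => by
    by_contra! h
    exact one_ne_zero ((Module.forall_dual_apply_eq_zero_iff K (1 : D i)).mp h)
  choose g hg using hg
  let F : (∀ i, Matrix (Fin (d i)) (Fin (d i)) (D i)) →ₗ[K] K :=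
    ∑ i, (g i) ∘ₗ (Matrix.traceLinearMap (Fin (d i)) K (D i)) ∘ₗ (LinearMap.proj i)
  refine ⟨F ∘ₗ e.toLinearMap, fun b hb => ?_⟩
  have hF : ∀ y, F (e b * y) = 0 := fun y => by
    have := hb (e.symm y)
    simpa using this
  apply e.injective
  rw [map_zero]
  funext i
  ext k l
  by_contra hne
  have h := hF (Pi.single i (Matrix.single l k ((e b i k l)⁻¹)))
  have hne' : e b i k l ≠ 0 := hne
  simp only [F, LinearMap.sum_apply, LinearMap.comp_apply, LinearMap.proj_apply, Pi.mul_apply,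
    Matrix.traceLinearMap_apply] at h
  rw [Finset.sum_eq_single i] at h
  · rw [Pi.single_eq_same, Matrix.trace_mul_single, op_smul_eq_mul, mul_inv_cancel₀ hne'] at h
    exact hg i h
  · intro j _ hj
    rw [Pi.single_eq_of_ne hj]; simp
  · simp

/-- Every linear functional on `KG` is represented through the symmetrizing form. -/
theorem groupAlgebra_repr (K G : Type*) [Field K] [Group G] [Fintype G]
    (F : MonoidAlgebra K G →ₗ[K] K) :
    ∃ a : MonoidAlgebra K G, ∀ b, (a * b).coeff 1 = F b := by
  classical
  refine ⟨MonoidAlgebra.ofCoeff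
    (Finsupp.equivFunOnFinite.symm fun g => F (MonoidAlgebra.single g⁻¹ 1)), fun b => ?_⟩
  induction b using MonoidAlgebra.induction_linear with
  | zero => simp
  | add x y hx hy => rw [mul_add, map_add, ← hx, ← hy]; rfl
  | single g r =>
    have : MonoidAlgebra.single g r = r • (MonoidAlgebra.single g 1 : MonoidAlgebra K G) := by
      simp
    rw [MonoidAlgebra.coeff_mul_single_apply, this, map_smul]
    simp [mul_comm]

/-- the Jacobson radical of the group algebra `KG` of a finite group over a
finite field is a checkable ideal: `J(KG) = {b | a * b = 0}` for some `a ∈ KG`. -/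
theorem stmt13 (K : Type*) [Field K] [Fintype K] (G : Type*) [Group G] [Fintype G] :
    ∃ a : MonoidAlgebra K G,
      ((⊥ : Ideal (MonoidAlgebra K G)).jacobson : Set (MonoidAlgebra K G)) =
        {b : MonoidAlgebra K G | a * b = 0} := by
  have hfin : Finite (MonoidAlgebra K G) :=
    Finite.of_injective (fun x : MonoidAlgebra K G => (x.coeff : G → K)) (fun x y h => by
      ext g
      exact congrFun h g)
  rw [Ideal.jacobson_bot]
  obtain ⟨f, hf⟩ := semisimple_frobenius K
    (MonoidAlgebra K G ⧸ Ring.jacobson (MonoidAlgebra K G))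
  let π := Ideal.Quotient.mkₐ K (Ring.jacobson (MonoidAlgebra K G))
  obtain ⟨a, ha⟩ := groupAlgebra_repr K G (f ∘ₗ π.toLinearMap)
  refine ⟨a, ?_⟩
  have hπ : ∀ b, π b = 0 ↔ b ∈ Ring.jacobson (MonoidAlgebra K G) := fun b =>
    Ideal.Quotient.eq_zero_iff_mem
  ext b
  rw [SetLike.mem_coe, ← hπ, Set.mem_ofPred_eq]
  constructor
  · intro hb
    ext g
    have h := ha (b * MonoidAlgebra.single g⁻¹ 1)
    rw [← mul_assoc, MonoidAlgebra.coeff_mul_single_apply] at h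
    simpa [hb] using h
  · intro hb
    apply hf
    intro x
    obtain ⟨x, rfl⟩ := Ideal.Quotient.mk_surjective x
    have h := ha (b * x)
    rw [← mul_assoc, hb] at h
    have h2 : f (π (b * x)) = 0 := by simpa using h.symm
    rw [map_mul] at h2
    exact h2
end

section
/- Let p be a prime, K a finite field of characteristic p, and G a finite group which is p-nilpotent with a cyclic Sylow p-subgroup. Then every right ideal of KG is principal, and consequently every right ideal of KG is checkable (i.e., KG is a code-checkable group algebra). -/
theorem aux_abstract {A B : Type*} [Ring A] [Ring B] [IsSemisimpleRing Bᵐᵒᵖ]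
    (ι : B →+* A) (lam : A →+ B) (hlam : ∀ x b, lam (x * ι b) = lam x * b)
    (F : ℕ → AddSubgroup A) (hmono : Monotone F)
    (hF : ∀ d x b, x ∈ F d → x * ι b ∈ F d)
    (u u' : A) (hu : u * u' = 1)
    (hF0 : ∀ x ∈ F 0, lam x = 0 → x = 0)
    (hFs : ∀ d, ∀ x ∈ F (d + 1), lam x = 0 → x * u ∈ F d)
    (m : ℕ) (hm : ∀ x, x ∈ F m)
    (I : AddSubgroup A) (hI : ∀ x y, x ∈ I → x * y ∈ I) :
    ∃ a ∈ I, ∀ x ∈ I, ∃ b, x = a * b := by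
  -- right ideals of `B` have idempotent generators
  have key : ∀ d, ∃ y ∈ I, y ∈ F d ∧ ∀ x ∈ I, x ∈ F d → lam y * lam x = lam x := by
    intro d
    let J : Ideal Bᵐᵒᵖ :=
      { carrier := {b | ∃ x ∈ I, x ∈ F d ∧ lam x = b.unop}
        zero_mem' := ⟨0, I.zero_mem, (F d).zero_mem, by simp⟩
        add_mem' := by
          rintro a b ⟨x, hx, hx', hxa⟩ ⟨y, hy, hy', hyb⟩
          exact ⟨x + y, I.add_mem hx hy, (F d).add_mem hx' hy', by simp [hxa, hyb]⟩
        smul_mem' := by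
          rintro c a ⟨x, hx, hx', hxa⟩
          exact ⟨x * ι c.unop, hI _ _ hx, hF _ _ _ hx', by simp [hlam, hxa]⟩ }
    obtain ⟨e, he, hJ⟩ := IsSemisimpleRing.ideal_eq_span_idempotent J
    have heJ : e ∈ J := by rw [hJ]; exact Ideal.mem_span_singleton_self e
    obtain ⟨y, hy, hy', hye⟩ := heJ
    refine ⟨y, hy, hy', fun x hx hx' => ?_⟩
    have hxJ : MulOpposite.op (lam x) ∈ J := ⟨x, hx, hx', rfl⟩
    rw [hJ, Ideal.mem_span_singleton'] at hxJ
    obtain ⟨c, hc⟩ := hxJ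
    have h1 : MulOpposite.op (lam x) * e = MulOpposite.op (lam x) := by
      rw [← hc, mul_assoc, he]
    have h2 := congrArg MulOpposite.unop h1
    simpa [hye] using h2
  have step : ∀ d, ∃ a ∈ I, a ∈ F d ∧ ∀ j ≤ d, ∀ x ∈ I, x ∈ F j →
      a * ι (lam x) ∈ F j ∧ lam a * lam x = lam x := by
    intro d
    induction d with
    | zero =>
      obtain ⟨y, hy, hy', h⟩ := key 0
      refine ⟨y, hy, hy', fun j hj x hx hx' => ?_⟩
      obtain rfl : j = 0 := by omega
      exact ⟨hF _ _ _ hy', h x hx hx'⟩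
    | succ d ih =>
      obtain ⟨a, ha, haF, h⟩ := ih
      obtain ⟨y, hy, hyF, hk⟩ := key (d + 1)
      have haF' : a ∈ F (d + 1) := hmono (Nat.le_succ d) haF
      have hmem : a + y * ι (1 - lam a) ∈ F (d + 1) :=
        (F _).add_mem haF' (hF _ _ _ hyF)
      have hl : lam (a + y * ι (1 - lam a)) = lam y := by
        rw [map_add, hlam, mul_sub, hk a ha haF', mul_one]; abel
      refine ⟨a + y * ι (1 - lam a), I.add_mem ha (hI _ _ hy), hmem, fun j hj x hx hxF => ?_⟩
      refine ⟨?_, ?_⟩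
      · rcases Nat.lt_or_ge d j with hlt | hle
        · obtain rfl : j = d + 1 := by omega
          exact hF _ _ _ hmem
        · have h0 := h j hle x hx hxF
          have : (a + y * ι (1 - lam a)) * ι (lam x) = a * ι (lam x) := by
            rw [add_mul, mul_assoc, ← map_mul, sub_mul, one_mul, h0.2]; simp
          rw [this]; exact h0.1
      · rw [hl]; exact hk x hx (hmono hj hxF)
  obtain ⟨a, ha, haF, h⟩ := step m
  refine ⟨a, ha, fun x hx => ?_⟩
  have main : ∀ d ≤ m, ∀ x ∈ I, x ∈ F d → ∃ b, x = a * b := by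
    intro d
    induction d with
    | zero =>
      intro hd x hx hxF
      have h0 := h 0 hd x hx hxF
      have := hF0 (x - a * ι (lam x)) ((F 0).sub_mem hxF h0.1) (by
        rw [map_sub, hlam, h0.2, sub_self])
      exact ⟨_, sub_eq_zero.mp this⟩
    | succ d ih =>
      intro hd x hx hxF
      have h0 := h (d + 1) hd x hx hxF
      have h1 := hFs d (x - a * ι (lam x)) ((F _).sub_mem hxF h0.1) (by
        rw [map_sub, hlam, h0.2, sub_self])
      obtain ⟨b, hb⟩ := ih (by omega) _ (hI _ u (I.sub_mem hx (hI _ (ι (lam x)) ha))) h1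
      refine ⟨ι (lam x) + b * u', ?_⟩
      rw [mul_add, ← mul_assoc, ← hb, mul_assoc, hu, mul_one]; abel
  exact main m le_rfl x hx (hm x)

theorem aux_cyclic (p : ℕ) [Fact p.Prime] (G : Type*) [Group G] [Finite G] (N : Subgroup G)
    [N.Normal] (k : ℕ) (hk : N.index = p ^ k) (hcyc : ∀ P : Sylow p G, IsCyclic P) :
    IsCyclic (G ⧸ N) := by
  obtain ⟨P⟩ : Nonempty (Sylow p G) := inferInstance
  have := hcyc P
  have h1 : (N ⊔ (P : Subgroup G)).index ∣ p ^ k := hk ▸ Subgroup.index_dvd_of_le le_sup_left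
  have h2 : (N ⊔ (P : Subgroup G)).index ∣ (P : Subgroup G).index :=
    Subgroup.index_dvd_of_le le_sup_right
  have h3 : (p ^ k).Coprime (P : Subgroup G).index :=
    Nat.Coprime.pow_left _ ((Nat.Prime.coprime_iff_not_dvd Fact.out).2 P.not_dvd_index)
  have h4 : N ⊔ (P : Subgroup G) = ⊤ :=
    Subgroup.index_eq_one.1 (Nat.eq_one_of_dvd_coprimes h3 h1 h2)
  refine isCyclic_of_surjective ((QuotientGroup.mk' N).comp (P : Subgroup G).subtype) ?_
  intro x
  obtain ⟨g, rfl⟩ := QuotientGroup.mk'_surjective N x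
  have hg : g ∈ N ⊔ (P : Subgroup G) := h4 ▸ Subgroup.mem_top g
  rw [Subgroup.mem_sup_of_normal_left] at hg
  obtain ⟨n, hn, q, hq, rfl⟩ := hg
  refine ⟨⟨q, hq⟩, ?_⟩
  have : QuotientGroup.mk' N n = 1 := by simpa using hn
  simp only [map_mul, this, one_mul]; rfl

open MonoidAlgebra in
theorem aux_principal (K : Type*) [Field K] (G : Type*) [Group G] [Finite G] (N : Subgroup G)
    [N.Normal] (hN : (Nat.card N : K) ≠ 0) [hc : IsCyclic (G ⧸ N)]
    (I : AddSubgroup (MonoidAlgebra K G)) (hI : ∀ x y, x ∈ I → x * y ∈ I) :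
    ∃ a ∈ I, ∀ x ∈ I, ∃ b, x = a * b := by
  obtain ⟨t, ht⟩ := hc.exists_generator
  obtain ⟨g, rfl⟩ := QuotientGroup.mk'_surjective N t
  have : NeZero (Nat.card N : K) := ⟨hN⟩
  have : IsSemisimpleRing (MonoidAlgebra K N) := inferInstance
  have : IsSemisimpleRing (MonoidAlgebra K N)ᵐᵒᵖ := isSemisimpleRing_mulOpposite_iff.2 this
  let φ := QuotientGroup.mk' N
  have hφ : ∀ x, φ x = 1 ↔ x ∈ N := fun x => by simp [φ]
  let ι : MonoidAlgebra K N →+* MonoidAlgebra K G := mapDomainRingHom K N.subtype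
  let lam : MonoidAlgebra K G →+ MonoidAlgebra K N :=
    { toFun := fun x => ofCoeff (x.coeff.comapDomain (↑) Subtype.val_injective.injOn)
      map_zero' := by ext; simp
      map_add' := fun x y => by ext; simp }
  have lam_coeff : ∀ x n, (lam x).coeff n = x.coeff (n : G) := fun x n => rfl
  let F : ℕ → AddSubgroup (MonoidAlgebra K G) := fun d =>
    { carrier := {x | ∀ h, x.coeff h ≠ 0 → ∃ i ≤ d, φ h = (φ g)⁻¹ ^ i}
      zero_mem' := by intro h; simp
      add_mem' := by
        intro x y hx hy h hh
        by_cases hxh : x.coeff h = 0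
        · exact hy h (by simpa [hxh] using hh)
        · exact hx h hxh
      neg_mem' := by
        intro x hx h hh
        exact hx h (by simpa using hh) }
  have ι_single : ∀ n r, ι (single n r) = single (n : G) r := fun n r => by simp [ι]
  have hlam : ∀ x b, lam (x * ι b) = lam x * b := by
    intro x b
    induction b using MonoidAlgebra.induction_linear with
    | zero => simp
    | add b c hb hc => rw [map_add, mul_add, map_add, hb, hc, mul_add]
    | single n r =>
      ext h
      rw [lam_coeff, ι_single, coeff_mul_single_apply, coeff_mul_single_apply, lam_coeff]
      simp
  have hF : ∀ d x b, x ∈ F d → x * ι b ∈ F d := by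
    intro d x b hx
    induction b using MonoidAlgebra.induction_linear with
    | zero => simp [(F d).zero_mem]
    | add b c hb hc => rw [map_add, mul_add]; exact (F d).add_mem hb hc
    | single n r =>
      intro h hh
      rw [ι_single, coeff_mul_single_apply] at hh
      obtain ⟨i, hi, hi'⟩ := hx _ (left_ne_zero_of_mul hh)
      refine ⟨i, hi, ?_⟩
      rw [← hi', map_mul, map_inv, (hφ n).2 n.2]; simp
  refine aux_abstract ι lam hlam F ?_ hF (single g 1) (single g⁻¹ 1) ?_ ?_ ?_
    (Nat.card (G ⧸ N)) ?_ I hI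
  · intro d e hde x hx h hh
    obtain ⟨i, hi, hi'⟩ := hx h hh
    exact ⟨i, hi.trans hde, hi'⟩
  · simp [single_mul_single, one_def]
  · intro x hx hl
    ext h
    by_contra hh
    obtain ⟨i, hi, hi'⟩ := hx h hh
    obtain rfl : i = 0 := by omega
    have hn : h ∈ N := by rw [← hφ]; simpa using hi'
    exact hh (by rw [← lam_coeff x ⟨h, hn⟩, hl]; simp)
  · intro d x hx hl h hh
    rw [coeff_mul_single_apply] at hh
    have hh' := left_ne_zero_of_mul hh
    obtain ⟨i, hi, hi'⟩ := hx _ hh'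
    rcases i with _ | i
    · have hn : h * g⁻¹ ∈ N := by rw [← hφ]; simpa using hi'
      exact absurd (by rw [← lam_coeff x ⟨_, hn⟩, hl]; simp) hh'
    · refine ⟨i, by omega, ?_⟩
      rw [pow_succ, map_mul, map_inv] at hi'
      exact mul_right_cancel hi'
  · intro x h hh
    classical
    have h1 := ht (φ h)
    rw [← Subgroup.zpowers_inv, ← mem_powers_iff_mem_zpowers] at h1
    have h2 := (IsOfFinOrder.mem_powers_iff_mem_range_orderOf (isOfFinOrder_of_finite _)).1 h1
    simp only [Finset.mem_image, Finset.mem_range] at h2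
    obtain ⟨i, hi, hi'⟩ := h2
    exact ⟨i, hi.le.trans (Nat.le_of_dvd Nat.card_pos (orderOf_dvd_natCard _)), hi'.symm⟩

open MonoidAlgebra in
/-- the canonical anti-automorphism of a group algebra -/
noncomputable def tauHom (K : Type*) [Field K] (G : Type*) [Group G] :
    MonoidAlgebra K G →ₐ[K] (MonoidAlgebra K G)ᵐᵒᵖ :=
  MonoidAlgebra.lift K (MonoidAlgebra K G)ᵐᵒᵖ G
    { toFun := fun g => MulOpposite.op (single g⁻¹ 1)
      map_one' := by simp [one_def]
      map_mul' := fun g h => by simp [← MulOpposite.op_mul, single_mul_single] }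

open MonoidAlgebra in
theorem tau_tau (K : Type*) [Field K] (G : Type*) [Group G] (x : MonoidAlgebra K G) :
    (tauHom K G (tauHom K G x).unop).unop = x := by
  induction x using MonoidAlgebra.induction_linear with
  | zero => simp
  | add b c hb hc => simp [hb, hc]
  | single n r => simp [tauHom]

open MonoidAlgebra in
theorem aux_trace_comm (K : Type*) [Field K] (G : Type*) [Group G] (x y : MonoidAlgebra K G) :
    (x * y).coeff 1 = (y * x).coeff 1 := by
  induction y using MonoidAlgebra.induction_linear with
  | zero => simp
  | add b c hb hc => simp [mul_add, add_mul, hb, hc]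
  | single n r => simp [mul_comm]

open MonoidAlgebra in
theorem aux_double_ann (K : Type*) [Field K] (G : Type*) [Group G] [Finite G]
    (I : Submodule K (MonoidAlgebra K G)) (hI : ∀ x y, x ∈ I → x * y ∈ I)
    (x : MonoidAlgebra K G) (hx : ∀ v : MonoidAlgebra K G, (∀ i ∈ I, v * i = 0) → v * x = 0) :
    x ∈ I := by
  let T : MonoidAlgebra K G →ₗ[K] K :=
    { toFun := fun x => x.coeff 1
      map_add' := fun x y => by simp
      map_smul' := fun x y => by simp }
  let B : LinearMap.BilinForm K (MonoidAlgebra K G) := (LinearMap.mul K _).compr₂ T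
  have hB : ∀ x y, B x y = (x * y).coeff 1 := fun x y => rfl
  have hrefl : B.IsRefl := fun x y h => by
    rw [hB] at h ⊢; rw [aux_trace_comm]; exact h
  have hnd : B.Nondegenerate := by
    refine (LinearMap.IsRefl.nondegenerate_iff_separatingLeft hrefl).2 ?_
    intro x h
    ext g
    have := h (single g⁻¹ 1)
    rw [hB] at this
    simpa using this
  have : FiniteDimensional K (MonoidAlgebra K G) := inferInstance
  rw [← B.orthogonal_orthogonal hnd hrefl I]
  intro v hv
  change B v x = 0
  have h0 : v * x = 0 := by
    refine hx v fun i hi => ?_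
    ext g
    have h1 := hv (i * single g⁻¹ 1) (hI _ _ hi)
    change B _ _ = 0 at h1
    rw [hB, aux_trace_comm, ← mul_assoc] at h1
    simpa using h1
  rw [hB, h0]; simp

/-- if `K` is a finite field of characteristic `p` and `G` is a finite
`p`-nilpotent group (it has a normal `p`-complement, i.e. a normal subgroup of order prime to `p` and `p`-power index) with cyclic Sylow `p`-subgroups, then
every right ideal of `KG` is principal, and consequently every right ideal of `KG` is
checkable. -/
theorem stmt15 (p : ℕ) [Fact p.Prime] (K : Type*) [Field K] [Fintype K] [CharP K p]
    (G : Type*) [Group G] [Fintype G]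
    (hnilp : ∃ N : Subgroup G, N.Normal ∧ ¬ p ∣ Nat.card N ∧ ∃ k : ℕ, N.index = p ^ k)
    (hcyc : ∀ P : Sylow p G, IsCyclic P) :
    (∀ I : Submodule (MonoidAlgebra K G)ᵐᵒᵖ (MonoidAlgebra K G),
        ∃ a : MonoidAlgebra K G,
          (I : Set (MonoidAlgebra K G)) =
            {x : MonoidAlgebra K G | ∃ b : MonoidAlgebra K G, x = a * b}) ∧
      (∀ I : Submodule (MonoidAlgebra K G)ᵐᵒᵖ (MonoidAlgebra K G),
        ∃ v : MonoidAlgebra K G,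
          (I : Set (MonoidAlgebra K G)) = {a : MonoidAlgebra K G | v * a = 0}) := by
  obtain ⟨N, hNn, hNp, k, hk⟩ := hnilp
  have hcy := aux_cyclic p G N k hk hcyc
  have hN : (Nat.card N : K) ≠ 0 := by
    rwa [Ne, CharP.cast_eq_zero_iff K p]
  have hsm : ∀ (I : Submodule (MonoidAlgebra K G)ᵐᵒᵖ (MonoidAlgebra K G)) (x y : MonoidAlgebra K G),
      x ∈ I → x * y ∈ I := fun I x y hx => I.smul_mem (MulOpposite.op y) hx
  refine ⟨fun I => ?_, fun I => ?_⟩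
  · obtain ⟨a, ha, h⟩ := aux_principal K G N hN I.toAddSubgroup (hsm I)
    refine ⟨a, Set.ext fun x => ⟨fun hx => h x hx, ?_⟩⟩
    rintro ⟨b, rfl⟩
    exact hsm I a b ha
  · let L : AddSubgroup (MonoidAlgebra K G) :=
      { carrier := {w | ∀ i ∈ I, (tauHom K G w).unop * i = 0}
        zero_mem' := by intro i _; simp
        add_mem' := by
          intro x y hx hy i hi
          simp [add_mul, hx i hi, hy i hi]
        neg_mem' := by
          intro x hx i hi
          simp [hx i hi] }
    obtain ⟨a, ha, h⟩ := aux_principal K G N hN L (by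
      intro x y hx i hi
      rw [map_mul, MulOpposite.unop_mul, mul_assoc, hx i hi, mul_zero])
    refine ⟨(tauHom K G a).unop, Set.ext fun x => ⟨fun hx => ha x hx, fun hx => ?_⟩⟩
    let I' : Submodule K (MonoidAlgebra K G) :=
      { I.toAddSubmonoid with
        smul_mem' := by
          intro c x hx
          have := hsm I x (algebraMap K _ c) hx
          rwa [← Algebra.commutes, ← Algebra.smul_def] at this }
    refine aux_double_ann K G I' (hsm I) x fun v hv => ?_
    obtain ⟨b, hb⟩ := h (tauHom K G v).unop (by
      intro i hi
      rw [tau_tau]; exact hv i hi)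
    have hx' : (tauHom K G a).unop * x = 0 := hx
    rw [← tau_tau K G v, hb, map_mul, MulOpposite.unop_mul, mul_assoc, hx', mul_zero]
end

section
/- Let p be a prime, K a finite field of characteristic p, and G a finite group such that every right ideal of the group algebra KG is checkable. Then G is p-nilpotent and its Sylow p-subgroups are cyclic. -/
namespace Stmt16

/-- The checkability of `K · ∑ g` yields a single vector controlling constant functions. -/
theorem exists_vec (K : Type*) [Field K] (G : Type*) [Group G] [Fintype G]
    (hcheck : ∀ I : Submodule (MonoidAlgebra K G)ᵐᵒᵖ (MonoidAlgebra K G),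
      ∃ v : MonoidAlgebra K G,
        (I : Set (MonoidAlgebra K G)) = {a : MonoidAlgebra K G | v * a = 0}) :
    ∃ v : G → K, ∑ x, v x = 0 ∧
      ∀ f : G → K, (∀ g, ∑ x, v x * f (g * x) = 0) → ∀ g, f g = f 1 := by
  classical
  have mul_left : ∀ (v a : MonoidAlgebra K G) (y : G),
      (v * a).coeff y = ∑ x, v.coeff x * a.coeff (x⁻¹ * y) := by
    intro v a y
    rw [MonoidAlgebra.coeff_mul_apply_left, Finsupp.sum_fintype]
    intro i; simp
  have mul_right : ∀ (v a : MonoidAlgebra K G) (y : G),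
      (v * a).coeff y = ∑ x, v.coeff (y * x⁻¹) * a.coeff x := by
    intro v a y
    rw [MonoidAlgebra.coeff_mul_apply_right, Finsupp.sum_fintype]
    intro i; simp
  let I : Submodule (MonoidAlgebra K G)ᵐᵒᵖ (MonoidAlgebra K G) :=
    { carrier := {a | ∀ g, a.coeff g = a.coeff 1}
      add_mem' := by
        intro a b ha hb g
        change ∀ g, a.coeff g = a.coeff 1 at ha
        change ∀ g, b.coeff g = b.coeff 1 at hb
        simp [ha g, hb g]
      zero_mem' := by intro g; simp
      smul_mem' := by
        intro r a ha g
        change ∀ g, a.coeff g = a.coeff 1 at ha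
        change (a * r.unop).coeff g = (a * r.unop).coeff 1
        rw [mul_right, mul_right]
        refine Finset.sum_congr rfl fun x _ => ?_
        rw [ha (g * x⁻¹), ha (1 * x⁻¹)] }
  obtain ⟨v, hv⟩ := hcheck I
  have hmem : ∀ a : MonoidAlgebra K G, (∀ g, a.coeff g = a.coeff 1) ↔ v * a = 0 := by
    intro a
    exact Set.ext_iff.1 hv a
  refine ⟨fun x => v.coeff x, ?_, fun f hf g => ?_⟩
  · have h1 := (hmem (MonoidAlgebra.ofCoeff (Finsupp.equivFunOnFinite.symm fun _ => 1))).1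
      (by intro g; simp)
    have h2 := congrArg (fun a => a.coeff 1) h1
    simpa [mul_left] using h2
  · have h1 := (hmem (MonoidAlgebra.ofCoeff (Finsupp.equivFunOnFinite.symm fun z => f z⁻¹))).2
      (by
        ext y
        rw [mul_left]
        simpa using hf y⁻¹)
    simpa using h1 g⁻¹

/-- Cocycles on a subgroup with values in a one-dimensional module are proportional. -/
theorem cocycles_dependent (K : Type*) [Field K] (G : Type*) [Group G] [Fintype G]
    (v : G → K) (hv0 : ∑ x, v x = 0)
    (hv : ∀ f : G → K, (∀ g, ∑ x, v x * f (g * x) = 0) → ∀ g, f g = f 1)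
    (H : Subgroup G) (χ : H →* K) (c₁ c₂ : H → K)
    (h₁ : ∀ a b, c₁ (a * b) = c₁ a + χ a * c₁ b)
    (h₂ : ∀ a b, c₂ (a * b) = c₂ a + χ a * c₂ b) :
    ∃ a b : K, (a ≠ 0 ∨ b ≠ 0) ∧ ∀ h, a * c₁ h + b * c₂ h = 0 := by
  classical
  -- extension of cocycles to the group
  have ext : ∀ c : H → K, (∀ a b, c (a * b) = c a + χ a * c b) →
      ∃ f : G → K, ∀ (h : H) (g : G), f (h * g) = c h + χ h * f g := by
    intro c hc
    obtain ⟨T, hT, -⟩ := H.exists_isComplement_right 1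
    refine ⟨fun g => c (hT.equiv g).1, fun h g => ?_⟩
    simp only [hT.equiv_mul_left]
    exact hc _ _
  obtain ⟨f₁, hf₁⟩ := ext c₁ h₁
  obtain ⟨f₂, hf₂⟩ := ext c₂ h₂
  let W : Submodule K (G → K) :=
    { carrier := {f | ∀ (h : H) (g : G), f (h * g) = χ h * f g}
      add_mem' := by
        intro a b ha hb h g
        simp only [Pi.add_apply, ha h g, hb h g]; ring
      zero_mem' := by intro h g; simp
      smul_mem' := by
        intro r a ha h g
        simp only [Pi.smul_apply, smul_eq_mul, ha h g]; ring }
  let F : (K × K) × W →ₗ[K] (G → K) :=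
    { toFun := fun t => t.1.1 • f₁ + t.1.2 • f₂ + t.2.1
      map_add' := by
        intro s t; ext g; simp; ring
      map_smul' := by
        intro r t; ext g; simp; ring }
  have hF : ∀ t (h : H) (g : G),
      F t (h * g) = (t.1.1 * c₁ h + t.1.2 * c₂ h) + χ h * F t g := by
    intro t h g
    have := t.2.2 h g
    simp only [F, LinearMap.coe_mk, AddHom.coe_mk, Pi.add_apply, Pi.smul_apply, smul_eq_mul,
      hf₁, hf₂, this]
    ring
  let T : (G → K) →ₗ[K] (G → K) :=
    { toFun := fun f g => ∑ x, v x * f (g * x)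
      map_add' := by
        intro s t; ext g; simp [mul_add, Finset.sum_add_distrib]
      map_smul' := by
        intro r t; ext g; simp [Finset.mul_sum, mul_left_comm] }
  have hTF : ∀ t, T (F t) ∈ W := by
    intro t h g
    change ∑ x, v x * F t (h * g * x) = χ h * ∑ x, v x * F t (g * x)
    have : ∀ x, v x * F t (h * g * x) =
        v x * (t.1.1 * c₁ h + t.1.2 * c₂ h) + χ h * (v x * F t (g * x)) := by
      intro x
      rw [mul_assoc, hF]; ring
    rw [Finset.sum_congr rfl fun x _ => this x, Finset.sum_add_distrib, ← Finset.sum_mul, hv0,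
      zero_mul, zero_add, ← Finset.mul_sum]
  let L : (K × K) × W →ₗ[K] W × K :=
    ((T.comp F).codRestrict W hTF).prod ((LinearMap.proj 1).comp F)
  have hL : LinearMap.ker L ≠ ⊥ := by
    apply LinearMap.ker_ne_bot_of_finrank_lt
    simp [Module.finrank_prod]
    omega
  obtain ⟨t, ht, ht0⟩ := (Submodule.ne_bot_iff _).1 hL
  rw [LinearMap.mem_ker] at ht
  have e1 : T (F t) = 0 := by
    have := congrArg (fun q => (q.1 : G → K)) ht
    simpa [L] using this
  have e2 : F t 1 = 0 := by
    have := congrArg (fun q => q.2) ht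
    simpa [L] using this
  have e3 : ∀ g, F t g = 0 := by
    intro g
    rw [hv (F t) (fun g => congrFun e1 g) g, e2]
  refine ⟨t.1.1, t.1.2, ?_, fun h => ?_⟩
  · by_contra hcon
    push Not at hcon
    apply ht0
    ext g
    · exact hcon.1
    · exact hcon.2
    · have := e3 g
      simpa [F, hcon.1, hcon.2] using this
  · have := hF t h 1
    rw [e3, e3] at this
    simpa using this.symm

/-- A maximal subgroup of a finite `p`-group is the kernel of a homomorphism to `(K, +)`. -/
theorem exists_hom_ker (p : ℕ) [Fact p.Prime] (K : Type*) [Field K] [CharP K p]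
    (P : Type*) [Group P] [Finite P] (hP : IsPGroup p P) (M : Subgroup P) (hM : IsCoatom M) :
    ∃ φ : P →* Multiplicative K, φ.ker = M := by
  have : Group.IsNilpotent P := hP.isNilpotent
  have hn : M.Normal := Subgroup.NormalizerCondition.normal_of_coatom M Group.normalizerCondition_of_isNilpotent hM
  have hidx : M.index = p := by
    obtain ⟨n, hn⟩ := IsPGroup.iff_card.1 hP
    obtain ⟨m, hm⟩ := IsPGroup.iff_card.1 (hP.to_subgroup M)
    have hci := M.card_mul_index
    have hp := (Fact.out : p.Prime)
    have hlt : m < n := by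
      have h1 : Nat.card M < Nat.card P := by
        refine lt_of_le_of_ne (Subgroup.card_le_card_group M) fun h => hM.1 ?_
        exact Subgroup.eq_top_of_card_eq M h
      rw [hm, hn] at h1
      exact (Nat.pow_lt_pow_iff_right hp.one_lt).1 h1
    obtain ⟨M', hc, hle⟩ := Sylow.exists_subgroup_card_pow_succ (p := p) (n := m)
      (by rw [hn]; exact pow_dvd_pow p hlt) hm
    have hlt' : M < M' := by
      refine lt_of_le_of_ne hle fun h => ?_
      rw [← h, hm] at hc
      have := Nat.pow_right_injective hp.two_le hc
      omega
    have htop := hM.2 _ hlt'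
    rw [htop, Subgroup.card_top] at hc
    rw [hc, hm, pow_succ] at hci
    exact Nat.eq_of_mul_eq_mul_left (pow_pos hp.pos m) hci
  have hcard : Nat.card (P ⧸ M) = p := hidx
  have hcard' : Nat.card (Multiplicative (ZMod p)) = p := by
    rw [Nat.card_congr Multiplicative.toAdd, Nat.card_zmod]
  let e : P ⧸ M ≃* Multiplicative (ZMod p) := mulEquivOfPrimeCardEq hcard hcard'
  let i : Multiplicative (ZMod p) →* Multiplicative K :=
    AddMonoidHom.toMultiplicative (ZMod.castHom (dvd_refl p) K).toAddMonoidHom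
  have hi : Function.Injective i := (ZMod.castHom (dvd_refl p) K).injective
  refine ⟨(i.comp e.toMonoidHom).comp (QuotientGroup.mk' M), ?_⟩
  ext x
  rw [MonoidHom.mem_ker]
  constructor
  · intro hx
    have h1 : e (QuotientGroup.mk' M x) = 1 := hi (by simpa using hx)
    have h2 : QuotientGroup.mk' M x = 1 := by simpa using h1
    simpa using h2
  · intro hx
    have h2 : QuotientGroup.mk' M x = 1 := by simpa using hx
    simp only [MonoidHom.comp_apply, h2, map_one]

theorem cyclic_of_dependent (p : ℕ) [Fact p.Prime] (K : Type*) [Field K] [CharP K p]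
    (P : Type*) [Group P] [Finite P] (hP : IsPGroup p P)
    (hdep : ∀ c₁ c₂ : P → K, (∀ a b, c₁ (a * b) = c₁ a + c₁ b) →
      (∀ a b, c₂ (a * b) = c₂ a + c₂ b) →
      ∃ a b : K, (a ≠ 0 ∨ b ≠ 0) ∧ ∀ h, a * c₁ h + b * c₂ h = 0) : IsCyclic P := by
  have huniq : ∀ M N : Subgroup P, IsCoatom M → IsCoatom N → M = N := by
    intro M N hM hN
    obtain ⟨φ, hφ⟩ := exists_hom_ker p K P hP M hM
    obtain ⟨ψ, hψ⟩ := exists_hom_ker p K P hP N hN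
    obtain ⟨a, b, hab, h⟩ := hdep (fun x => (φ x).toAdd) (fun x => (ψ x).toAdd)
      (by simp) (by simp)
    have hφ' : ∀ x, x ∈ M ↔ (φ x).toAdd = 0 := by
      intro x; rw [← hφ, MonoidHom.mem_ker]; exact Iff.rfl
    have hψ' : ∀ x, x ∈ N ↔ (ψ x).toAdd = 0 := by
      intro x; rw [← hψ, MonoidHom.mem_ker]; exact Iff.rfl
    rcases hab with ha | hb
    · have hle : N ≤ M := by
        intro x hx
        rw [hφ']
        have := h x
        rw [(hψ' x).1 hx] at this
        simpa [ha] using this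
      by_contra hne
      exact hM.1 (hN.2 M (lt_of_le_of_ne hle (Ne.symm hne)))
    · have hle : M ≤ N := by
        intro x hx
        rw [hψ']
        have := h x
        rw [(hφ' x).1 hx] at this
        simpa [hb] using this
      by_contra hne
      exact hN.1 (hM.2 N (lt_of_le_of_ne hle hne))
  rcases eq_top_or_exists_le_coatom (⊥ : Subgroup P) with h | ⟨M, hM, -⟩
  · have : Subsingleton P := Subgroup.subsingleton_iff.1 (subsingleton_of_bot_eq_top h)
    infer_instance
  · obtain ⟨x, hx⟩ : ∃ x, x ∉ M := by
      by_contra hcon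
      push Not at hcon
      exact hM.1 ((Subgroup.eq_top_iff' M).2 hcon)
    rcases eq_top_or_exists_le_coatom (Subgroup.zpowers x) with h | ⟨N, hN, hle⟩
    · exact ⟨x, fun y => by
        have : y ∈ (⊤ : Subgroup P) := Subgroup.mem_top y
        rwa [← h] at this⟩
    · exact absurd (huniq M N hM hN ▸ hle (Subgroup.mem_zpowers x)) hx

theorem central_of_dependent (p : ℕ) [Fact p.Prime] (K : Type*) [Field K] [CharP K p]
    (H : Type*) [Group H] [Finite H] (P : Sylow p H) [P.Normal] [IsCyclic P]
    (hdep : ∀ (χ : H →* K) (c₁ c₂ : H → K), (∀ a b, c₁ (a * b) = c₁ a + χ a * c₁ b) →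
      (∀ a b, c₂ (a * b) = c₂ a + χ a * c₂ b) →
      ∃ a b : K, (a ≠ 0 ∨ b ≠ 0) ∧ ∀ h, a * c₁ h + b * c₂ h = 0) :
    (P : Subgroup H) ≤ Subgroup.center H := by
  obtain ⟨Q, hQ⟩ := Subgroup.exists_left_complement'_of_coprime P.card_coprime_index
  rcases Sylow.commutator_eq_bot_or_commutator_eq_self P hQ with h | h
  · replace h := sup_le (Subgroup.commutator_eq_bot_iff_le_centralizer.mp h) P.le_centralizer
    rwa [hQ.sup_eq_top, top_le_iff, Subgroup.centralizer_eq_top_iff_subset] at h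
  rcases eq_top_or_exists_le_coatom (⊥ : Subgroup P) with h0 | ⟨M, hM, -⟩
  · have h1 : Subsingleton P := Subgroup.subsingleton_iff.1 (subsingleton_of_bot_eq_top h0)
    intro x hx
    have : (⟨x, hx⟩ : P) = 1 := Subsingleton.elim _ _
    rw [Subtype.ext_iff] at this
    simp only [OneMemClass.coe_one] at this
    rw [this]
    exact one_mem _
  exfalso
  obtain ⟨φ', hφ'⟩ := exists_hom_ker p K P P.2 M hM
  obtain ⟨u, hu⟩ := IsCyclic.exists_generator (α := P)
  let φ : P → K := fun x => (φ' x).toAdd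
  have φmul : ∀ x y, φ (x * y) = φ x + φ y := by intro x y; simp [φ]
  have φpow : ∀ (n : ℤ) x, φ (x ^ n) = n * φ x := by intro n x; simp [φ]
  have hφu : φ u ≠ 0 := by
    intro hz
    apply hM.1
    rw [Subgroup.eq_top_iff']
    intro x
    obtain ⟨n, rfl⟩ := hu x
    rw [← hφ', MonoidHom.mem_ker]
    change φ (u ^ n) = 0
    rw [φpow, hz, mul_zero]
  have hcomm : ∀ x y : P, x * y = y * x := by
    intro x y
    obtain ⟨n, rfl⟩ := hu x
    obtain ⟨m, rfl⟩ := hu y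
    exact zpow_mul_comm u n m
  let cj : H →* MulAut (P : Subgroup H) := MulAut.conjNormal
  have hconj : ∀ (h : H) (x : P), φ (cj h x) = φ (cj h u) / φ u * φ x := by
    intro h x
    obtain ⟨n, rfl⟩ := hu x
    change φ (cj h (u ^ n)) = φ (cj h u) / φ u * φ (u ^ n)
    rw [map_zpow, φpow, φpow]
    field_simp
  let χ : H →* K :=
    { toFun := fun h => φ (cj h u) / φ u
      map_one' := by
        rw [map_one]; exact div_self hφu
      map_mul' := by
        intro a b
        rw [map_mul, MulAut.mul_apply, hconj]
        ring }
  have hχ : ∀ (h : H) (x : P), φ (cj h x) = χ h * φ x := hconj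
  have hχP : ∀ x : P, χ x = 1 := by
    intro x
    have : cj x u = u := by
      ext
      simp only [cj, MulAut.conjNormal_apply]
      have : (x * u : H) = u * x := congrArg (Subtype.val) (hcomm x u)
      rw [this]; group
    change φ (cj x u) / φ u = 1
    rw [this]; exact div_self hφu
  have hPQ := hQ.symm
  let c : H → K := fun h => φ (hPQ.equiv h).1
  have hc0 : ∀ (x : P) (q : Q), c (x * q) = φ x := by
    intro x q
    have : hPQ.equiv (x * q : H) = (x, q) := by
      rw [← Equiv.eq_symm_apply]; rfl
    simp only [c, this]
  have hdec : ∀ h : H, ∃ (x : P) (q : Q), h = x * q := fun h =>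
    ⟨(hPQ.equiv h).1, (hPQ.equiv h).2, (hPQ.equiv_fst_mul_equiv_snd h).symm⟩
  have hc : ∀ a b, c (a * b) = c a + χ a * c b := by
    intro a b
    obtain ⟨x, q, rfl⟩ := hdec a
    obtain ⟨y, r, rfl⟩ := hdec b
    have : (x * q * (y * r) : H) = ((x * cj q y : P) : H) * ((q * r : Q) : H) := by
      change (x * q * (y * r) : H) = x * (q * y * (q : H)⁻¹) * (q * r)
      group
    rw [this, hc0, hc0, hc0, φmul, hχ, map_mul, hχP, one_mul]
  obtain ⟨a, b, hab, hrel⟩ := hdep χ c (fun h => χ h - 1) hc (by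
    intro a b; rw [map_mul]; ring)
  have ha : a = 0 := by
    have h1 := hrel u
    have h2 := hc0 u 1
    simp only [OneMemClass.coe_one, mul_one] at h2
    rw [h2, hχP, sub_self, mul_zero, add_zero] at h1
    exact (mul_eq_zero.1 h1).resolve_right hφu
  have hb : b ≠ 0 := hab.resolve_left (fun h => h ha)
  have hχ1 : ∀ h, χ h = 1 := by
    intro h
    have := hrel h
    rw [ha, zero_mul, zero_add] at this
    exact sub_eq_zero.1 ((mul_eq_zero.1 this).resolve_left hb)
  have hle : ⁅Q, P.1⁆ ≤ M.map (P : Subgroup H).subtype := by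
    rw [Subgroup.commutator_le]
    intro q hq x hx
    refine ⟨cj q ⟨x, hx⟩ * ⟨x, hx⟩⁻¹, ?_, ?_⟩
    · change _ ∈ M
      rw [← hφ', MonoidHom.mem_ker]
      change φ (cj q ⟨x, hx⟩ * ⟨x, hx⟩⁻¹) = 0
      have h3 := φmul (⟨x, hx⟩ : P) (⟨x, hx⟩ : P)⁻¹
      have h4 : φ 1 = 0 := by simp [φ]
      rw [mul_inv_cancel, h4] at h3
      rw [φmul, hχ, hχ1, one_mul, ← h3]
    · simp [cj, commutatorElement_def]
  rw [h] at hle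
  apply hM.1
  rw [Subgroup.eq_top_iff']
  intro x
  obtain ⟨y, hy, hyx⟩ := hle x.2
  have : y = x := Subtype.ext hyx
  exact this ▸ hy

end Stmt16

/-- if `K` is a finite field of characteristic `p` and every right ideal of
the group algebra `KG` of the finite group `G` is checkable, then `G` is `p`-nilpotent
(has a normal `p`-complement) and its Sylow `p`-subgroups are cyclic. -/
theorem stmt16 (p : ℕ) [Fact p.Prime] (K : Type*) [Field K] [Fintype K] [CharP K p]
    (G : Type*) [Group G] [Fintype G]
    (hcheck : ∀ I : Submodule (MonoidAlgebra K G)ᵐᵒᵖ (MonoidAlgebra K G),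
      ∃ v : MonoidAlgebra K G,
        (I : Set (MonoidAlgebra K G)) = {a : MonoidAlgebra K G | v * a = 0}) :
    (∃ N : Subgroup G, N.Normal ∧ ¬ p ∣ Nat.card N ∧ ∃ k : ℕ, N.index = p ^ k) ∧
      ∀ P : Sylow p G, IsCyclic P := by
  obtain ⟨v, hv0, hv⟩ := Stmt16.exists_vec K G hcheck
  have hdep := Stmt16.cocycles_dependent K G v hv0 hv
  have hcyc : ∀ P : Sylow p G, IsCyclic P := by
    intro P
    refine Stmt16.cyclic_of_dependent p K P P.2 fun c₁ c₂ h₁ h₂ => ?_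
    exact hdep P 1 c₁ c₂ (by simpa using h₁) (by simpa using h₂)
  refine ⟨?_, hcyc⟩
  obtain ⟨P⟩ : Nonempty (Sylow p G) := inferInstance
  have := hcyc P
  have hNC : Subgroup.normalizer P ≤ Subgroup.centralizer (P : Set G) := by
    let Q : Sylow p (Subgroup.normalizer (P : Set G)) := P.subtype P.le_normalizer
    have : Q.Normal := P.normal_in_normalizer
    have : IsCyclic Q :=
      isCyclic_of_surjective _ (Subgroup.subgroupOfEquivOfLe P.le_normalizer).symm.surjective
    have hcen := Stmt16.central_of_dependent p K _ Q (hdep _)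
    intro n hn x hx
    have h1 : (⟨x, P.le_normalizer hx⟩ : Subgroup.normalizer (P : Set G)) ∈ (Q : Subgroup _) := hx
    have h2 := Subgroup.mem_center_iff.1 (hcen h1) ⟨n, hn⟩
    exact (congrArg Subtype.val h2).symm
  refine ⟨(MonoidHom.transferSylow P hNC).ker, inferInstance,
    MonoidHom.not_dvd_card_ker_transferSylow P hNC, ?_⟩
  have hc := (MonoidHom.ker_transferSylow_isComplement' P hNC).symm.index_eq_card
  rw [hc]
  exact IsPGroup.iff_card.1 P.2
end

section
/- Let p be a prime, K a finite field of characteristic p, G an elementary abelian p-group of rank m > 1, and J the Jacobson radical of KG. Then among the powers J^r for 0 < r ≤ N where N = m(p-1) is the nilpotency degree minus... (J^N ≠ 0, J^{N+1} = 0), the only power J^r with 0 < r ≤ N that is a principal ideal is J^N, which is the one-dimensional span of Σ_{g∈G} g. -/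
section Aux

open Finset
open scoped Pointwise

lemma exists_le_sum {ι : Type*} [Fintype ι] [DecidableEq ι] (d : ι → ℕ) (s : ℕ) (h : s ≤ ∑ i, d i) :
    ∃ c : ι → ℕ, (∀ i, c i ≤ d i) ∧ ∑ i, c i = s := by
  induction s with
  | zero => exact ⟨0, by simp, by simp⟩
  | succ s ih =>
    obtain ⟨c, hc, hs⟩ := ih (by omega)
    obtain ⟨i, -, hi⟩ := Finset.exists_lt_of_sum_lt (s := Finset.univ) (f := c) (g := d) (by omega)
    refine ⟨c + Pi.single i 1, fun j => ?_, ?_⟩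
    · by_cases hj : j = i
      · subst hj; simp; omega
      · simp [hj, hc]
    · simp [Finset.sum_add_distrib, hs]

def mon {A ι : Type*} [CommRing A] [Fintype ι] (x : ι → A) (c : ι → ℕ) : A := ∏ i, x i ^ c i

lemma mon_add {A ι : Type*} [CommRing A] [Fintype ι] (x : ι → A) (c d : ι → ℕ) :
    mon x (c + d) = mon x c * mon x d := by
  simp [mon, pow_add, Finset.prod_mul_distrib]

lemma mon_mem {A ι : Type*} [CommRing A] [Fintype ι] (x : ι → A) (c : ι → ℕ) :
    mon x c ∈ (Ideal.span (Set.range x)) ^ (∑ i, c i) := by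
  rw [← Finset.prod_pow_eq_pow_sum]
  exact Ideal.prod_mem_prod fun i _ => Ideal.pow_mem_pow (Ideal.subset_span (Set.mem_range_self i)) _

lemma mon_zero {A ι : Type*} [CommRing A] [Fintype ι] (x : ι → A) (p : ℕ) (hx : ∀ i, x i ^ p = 0)
    (c : ι → ℕ) (i : ι) (h : p ≤ c i) : mon x c = 0 :=
  Finset.prod_eq_zero (Finset.mem_univ i) (pow_eq_zero_of_le h (hx i))

lemma mon_ne {A ι : Type*} [CommRing A] [Fintype ι] (x : ι → A) (n : ℕ)
    (hP : mon x (fun _ => n) ≠ 0) (c : ι → ℕ) (h : ∀ i, c i ≤ n) : mon x c ≠ 0 := by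
  intro h0
  apply hP
  have : (fun _ : ι => n) = c + fun i => n - c i := by
    funext i; have := h i; simp; omega
  rw [this, mon_add, h0, zero_mul]

lemma topPow {A ι : Type*} [CommRing A] [Fintype ι] [DecidableEq ι] (x : ι → A) (n : ℕ)
    (hx : ∀ i, x i ^ (n + 1) = 0) :
    (Ideal.span (Set.range x)) ^ (Fintype.card ι * n) = Ideal.span {mon x (fun _ => n)} := by
  apply le_antisymm
  · have hsp : (Ideal.span (Set.range x)) ^ (Fintype.card ι * n) =
        Ideal.span ((Set.range x) ^ (Fintype.card ι * n)) := Submodule.span_pow (R := A) _ _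
    rw [hsp, Ideal.span_le]
    intro y hy
    rw [Set.mem_pow] at hy
    obtain ⟨f, rfl⟩ := hy
    choose g hg using fun k => (f k).2
    rw [List.prod_ofFn]
    have e : ∏ k, ((f k : A)) = mon x (fun i => #{k | g k = i}) := by
      simp_rw [← hg]
      rw [Finset.prod_comp x g]
      unfold mon
      refine Finset.prod_subset (Finset.subset_univ _) fun i _ hi => ?_
      rw [Finset.card_eq_zero.2, pow_zero]
      rw [Finset.filter_eq_empty_iff]
      intro k _ hk
      exact hi (Finset.mem_image.2 ⟨k, Finset.mem_univ _, hk⟩)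
    rw [e]
    by_cases h : ∃ i, n + 1 ≤ #{k | g k = i}
    · obtain ⟨i, hi⟩ := h
      rw [mon_zero x (n + 1) hx (fun i => #{k | g k = i}) i hi]
      exact Ideal.zero_mem _
    · push Not at h
      have hs : ∑ i, #{k | g k = i} = ∑ i : ι, n := by
        rw [← Finset.card_eq_sum_card_fiberwise (fun _ _ => Finset.mem_coe.2 (Finset.mem_univ _))]
        simp
      have := (Finset.sum_eq_sum_iff_of_le (fun i _ => Nat.lt_succ_iff.1 (h i))).1 hs
      have h2 : (fun i => #{k | g k = i}) = fun _ => n := funext fun i => this i (Finset.mem_univ _)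
      rw [h2]
      exact Ideal.subset_span rfl
  · rw [Ideal.span_singleton_le_iff_mem]
    simpa using mon_mem x (fun _ => n)

lemma topPow_succ {A ι : Type*} [CommRing A] [Fintype ι] [DecidableEq ι] (x : ι → A) (n : ℕ)
    (hx : ∀ i, x i ^ (n + 1) = 0) :
    (Ideal.span (Set.range x)) ^ (Fintype.card ι * n + 1) = ⊥ := by
  rw [pow_succ, topPow x n hx, Ideal.span_mul_span', Ideal.span_eq_bot]
  rintro y ⟨a, rfl, b, ⟨i, rfl⟩, rfl⟩
  have : x i = mon x (Pi.single i 1) := by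
    simp [mon, Pi.single_apply]
  simp only
  rw [this, ← mon_add]
  exact mon_zero x _ hx _ i (by simp)

lemma not_principal {A ι : Type*} [CommRing A] [Fintype ι] [DecidableEq ι] (x : ι → A) (n : ℕ)
    (hn : 0 < n)
    (hx : ∀ i, x i ^ (n + 1) = 0) (hP : mon x (fun _ => n) ≠ 0)
    (hloc : ∀ u, u ∈ Ideal.span (Set.range x) ∨ IsUnit u)
    (i j : ι) (hij : i ≠ j) (r : ℕ) (hr : 0 < r) (hr' : r < Fintype.card ι * n) (a : A)
    (ha : (Ideal.span (Set.range x)) ^ r = Ideal.span {a}) : False := by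
  have hbot := topPow_succ x n hx
  set J := Ideal.span (Set.range x) with hJ
  obtain ⟨c, hc, hs⟩ := exists_le_sum (fun k => n - (Pi.single i 1 + Pi.single j 1 : ι → ℕ) k) (r - 1) (by
    have : ∑ k, (n - (Pi.single i 1 + Pi.single j 1 : ι → ℕ) k) + ∑ k, (Pi.single i 1 + Pi.single j 1 : ι → ℕ) k = ∑ k : ι, n := by
      rw [← Finset.sum_add_distrib]
      refine Finset.sum_congr rfl fun k _ => Nat.sub_add_cancel ?_
      by_cases h1 : k = i
      · subst h1; simp [hij]; omega
      · by_cases h2 : k = j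
        · subst h2; simp [h1]; omega
        · simp [h1, h2]
    have h2 : ∑ k, (Pi.single i 1 + Pi.single j 1 : ι → ℕ) k = 2 := by simp [Finset.sum_add_distrib]
    rw [h2] at this
    simp at this
    simp only [Pi.add_apply] 
    omega)
  have hci : c i + 1 ≤ n := by have := hc i; simp [hij] at this; omega
  have hcj : c j + 1 ≤ n := by have := hc j; simp [hij.symm] at this; omega
  have hcn : ∀ k, c k ≤ n := fun k => (hc k).trans (Nat.sub_le _ _)
  have key : ∀ k, c k + 1 ≤ n → mon x (c + Pi.single k 1) ∈ J ^ r ∧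
      mon x (c + Pi.single k 1) ∉ J ^ (r + 1) := by
    intro k hk
    have hsum : ∑ l, (c + Pi.single k 1 : ι → ℕ) l = r := by
      simp [Finset.sum_add_distrib, hs]; omega
    have hle : ∀ l, (c + Pi.single k 1 : ι → ℕ) l ≤ n := by
      intro l
      by_cases h : l = k
      · subst h; simpa using hk
      · simpa [h] using hcn l
    generalize c + Pi.single k 1 = d at hsum hle
    refine ⟨hsum ▸ mon_mem x d, fun hmem => hP ?_⟩
    have e : (fun _ : ι => n) = d + fun i => n - d i := by
      funext i; have := hle i; simp; omega
    have hs2 : r + ∑ i, (n - d i) = Fintype.card ι * n := by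
      rw [← hsum, ← Finset.sum_add_distrib, Finset.sum_congr rfl fun k _ => Nat.add_sub_cancel' (hle k)]
      simp
    have := Ideal.mul_mem_mul hmem (mon_mem x (fun i => n - d i))
    rw [← mon_add, ← e, ← pow_add, add_right_comm, hs2, hbot] at this
    simpa using this
  obtain ⟨h1, h2⟩ := key i hci
  obtain ⟨h3, -⟩ := key j hcj
  have haJ : a ∈ J ^ r := ha ▸ Ideal.subset_span rfl
  have h1' := h1
  rw [ha, Ideal.mem_span_singleton'] at h1 h3
  obtain ⟨u, hu⟩ := h1
  obtain ⟨v, hv⟩ := h3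
  have hunit : IsUnit u := by
    refine (hloc u).resolve_left fun huJ => h2 ?_
    rw [← hu, pow_succ']
    exact Ideal.mul_mem_mul huJ haJ
  obtain ⟨w, rfl⟩ := hunit
  have hz : mon x (Pi.single i (n - c i)) * mon x (c + Pi.single i 1) = 0 := by
    rw [← mon_add]
    exact mon_zero x _ hx _ i (by simp; omega)
  have hz2 : mon x (Pi.single i (n - c i)) * a = 0 := by
    rw [← hu, mul_left_comm] at hz
    exact (Units.mul_right_eq_zero w).1 hz
  have hz3 : mon x (Pi.single i (n - c i)) * mon x (c + Pi.single j 1) = 0 := by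
    rw [← hv, mul_left_comm, hz2, mul_zero]
  rw [← mon_add] at hz3
  refine mon_ne x n hP _ (fun k => ?_) hz3
  by_cases h : k = i
  · subst h; simp [hij]; omega
  · by_cases h' : k = j
    · subst h'; simp [h]; omega
    · simpa [h, h'] using hcn k

lemma geom_char {p : ℕ} [Fact p.Prime] (K : Type*) [Field K] [CharP K p] {A : Type*} [CommRing A] [Algebra K A] (g : A) :
    (g - 1) ^ (p - 1) = ∑ k ∈ Finset.range p, g ^ k := by
  have hp : 0 < p := (Fact.out : p.Prime).pos
  have h : (Polynomial.X - 1 : Polynomial K) ^ (p - 1) = ∑ k ∈ Finset.range p, Polynomial.X ^ k := by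
    have hne : (Polynomial.X - 1 : Polynomial K) ≠ 0 := by
      simpa using Polynomial.X_sub_C_ne_zero (1 : K)
    apply mul_right_cancel₀ hne
    rw [geom_sum_mul, ← pow_succ, Nat.sub_add_cancel hp, sub_pow_char, one_pow]
  simpa using congrArg (Polynomial.aeval g) h

lemma exists_gens (p : ℕ) [Fact p.Prime] (G : Type*) [CommGroup G] [Fintype G] (m : ℕ)
    (helem : ∀ x : G, x ^ p = 1) (hcard : Fintype.card G = p ^ m) :
    ∃ g : Fin m → G, Function.Bijective (fun f : Fin m → Fin p => ∏ i, g i ^ (f i : ℕ)) := by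
  have : NeZero p := ⟨(Fact.out : p.Prime).ne_zero⟩
  let _ : Module (ZMod p) (Additive G) := AddCommGroup.zmodModule (n := p) (fun x => helem x.toMul)
  have hfr : Module.finrank (ZMod p) (Additive G) = m := by
    have h := Module.card_eq_pow_finrank (K := ZMod p) (V := Additive G)
    rw [Fintype.card_additive, hcard, ZMod.card] at h
    exact (Nat.pow_right_injective (Fact.out : p.Prime).two_le h).symm
  let b := Module.finBasisOfFinrankEq (ZMod p) (Additive G) hfr
  refine ⟨fun i => (b i).toMul, ?_⟩
  have hcc : Fintype.card (Fin m → Fin p) = Fintype.card G := by simp [hcard]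
  rw [Fintype.bijective_iff_surjective_and_card]
  refine ⟨fun y => ?_, hcc⟩
  refine ⟨fun i => ⟨(b.repr (Additive.ofMul y) i).val, ZMod.val_lt _⟩, ?_⟩
  have h := b.sum_repr (Additive.ofMul y)
  apply Additive.ofMul.injective
  rw [ofMul_prod]
  refine Eq.trans ?_ h
  refine Finset.sum_congr rfl fun i _ => ?_
  rw [ofMul_pow]
  simp only [ofMul_toMul]
  rw [← Nat.cast_smul_eq_nsmul (ZMod p), ZMod.natCast_zmod_val]

end Aux


/-- let `K` be a finite field of characteristic `p`, `G` an elementary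
abelian `p`-group of rank `m > 1`, `J` the Jacobson radical of `KG` and `N = m(p-1)`
(so `J^N ≠ 0` and `J^(N+1) = 0`). Among the powers `J^r` with `0 < r ≤ N`, the only
principal one is `J^N`, which is the span of `Σ_{g ∈ G} g`. -/
theorem stmt17 (p : ℕ) [Fact p.Prime] (K : Type*) [Field K] [Fintype K] [CharP K p]
    (G : Type*) [CommGroup G] [Fintype G] (m : ℕ) (hm : 1 < m)
    (helem : ∀ x : G, x ^ p = 1) (hcard : Fintype.card G = p ^ m) :
    (∀ r : ℕ, 0 < r → r ≤ m * (p - 1) →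
      ((∃ a : MonoidAlgebra K G,
          (⊥ : Ideal (MonoidAlgebra K G)).jacobson ^ r = Ideal.span {a}) ↔
        r = m * (p - 1))) ∧
    (⊥ : Ideal (MonoidAlgebra K G)).jacobson ^ (m * (p - 1)) =
      Ideal.span {∑ g : G, MonoidAlgebra.single g (1 : K)} := by
  have hp2 : 2 ≤ p := (Fact.out : p.Prime).two_le
  have hp1 : p - 1 + 1 = p := by omega
  obtain ⟨g, hg⟩ := exists_gens p G m helem hcard
  let o : G →* MonoidAlgebra K G := MonoidAlgebra.of K G
  let x : Fin m → MonoidAlgebra K G := fun i => o (g i) - 1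
  have : CharP (MonoidAlgebra K G) p := charP_of_injective_algebraMap (algebraMap K _).injective p
  have hx : ∀ i, x i ^ (p - 1 + 1) = 0 := by
    intro i
    simp only [x]
    rw [hp1, sub_pow_char, ← map_pow, helem, map_one, one_pow, sub_self]
  have hmon : mon x (fun _ => p - 1) = ∑ g : G, MonoidAlgebra.single g (1 : K) := by
    simp only [mon, x]
    simp_rw [geom_char K, ← Fin.sum_univ_eq_sum_range]
    rw [Finset.prod_univ_sum, Fintype.piFinset_univ, ← hg.sum_comp (fun g => MonoidAlgebra.single g (1 : K))]
    refine Finset.sum_congr rfl fun f _ => ?_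
    simp_rw [← map_pow, ← map_prod]
    rfl
  have hne : mon x (fun _ => p - 1) ≠ 0 := by
    rw [hmon]
    intro h
    have := congrArg (fun a : MonoidAlgebra K G => a.coeff 1) h
    simp [Finsupp.finsetSum_apply] at this
  have hpart := topPow x (p - 1) hx
  have hbot := topPow_succ x (p - 1) hx
  have hnp := not_principal x (p - 1) (by omega) hx hne
  rw [Fintype.card_fin] at hpart hbot hnp
  have hnil : ∀ u ∈ Ideal.span (Set.range x), IsNilpotent u := by
    intro u hu
    refine ⟨m * (p - 1) + 1, ?_⟩
    have := Ideal.pow_mem_pow hu (m * (p - 1) + 1)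
    rw [hbot] at this
    simpa using this
  -- every element is scalar plus element of the span
  have hdec : ∀ u : MonoidAlgebra K G, ∃ c : K, u - algebraMap K _ c ∈ Ideal.span (Set.range x) := by
    have hof : ∀ y : G, o y - 1 ∈ Ideal.span (Set.range x) := by
      intro y
      obtain ⟨f, rfl⟩ := hg.2 y
      rw [← Ideal.Quotient.eq]
      simp only [map_prod, map_pow, map_one]
      refine Finset.prod_eq_one fun i _ => ?_
      have : Ideal.Quotient.mk (Ideal.span (Set.range x)) (o (g i)) = 1 := by
        rw [← map_one (Ideal.Quotient.mk _), Ideal.Quotient.eq]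
        exact Ideal.subset_span (Set.mem_range_self i)
      rw [this, one_pow]
    intro u
    induction u using MonoidAlgebra.induction_on with
    | of y => exact ⟨1, by rw [map_one]; exact hof y⟩
    | add a b ha hb =>
      obtain ⟨c, hc⟩ := ha
      obtain ⟨d, hd⟩ := hb
      refine ⟨c + d, ?_⟩
      rw [map_add, add_sub_add_comm]
      exact Ideal.add_mem _ hc hd
    | smul r a ha =>
      obtain ⟨c, hc⟩ := ha
      refine ⟨r * c, ?_⟩
      rw [map_mul, Algebra.smul_def, ← mul_sub]
      exact Ideal.mul_mem_left _ _ hc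
  have hloc : ∀ u, u ∈ Ideal.span (Set.range x) ∨ IsUnit u := by
    intro u
    obtain ⟨c, hc⟩ := hdec u
    by_cases h0 : c = 0
    · left; simpa [h0] using hc
    · right
      have hu : IsUnit (algebraMap K (MonoidAlgebra K G) c) := (IsUnit.mk0 c h0).map _
      have := (hnil _ hc).isUnit_add_left_of_commute hu (Commute.all _ _)
      simpa using this
  have hJ : (⊥ : Ideal (MonoidAlgebra K G)).jacobson = Ideal.span (Set.range x) := by
    apply le_antisymm
    · intro u hu
      refine (hloc u).resolve_right fun h => ?_
      have := Ideal.eq_top_of_isUnit_mem _ hu h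
      rw [Ideal.jacobson_eq_top_iff] at this
      exact bot_ne_top this
    · rw [Ideal.span_le]
      rintro _ ⟨i, rfl⟩
      exact Ideal.radical_le_jacobson ⟨p - 1 + 1, by rw [hx i]; exact Ideal.zero_mem _⟩
  rw [hJ, hpart, hmon]
  refine ⟨fun r hr hrN => ⟨?_, ?_⟩, rfl⟩
  · rintro ⟨a, ha⟩
    by_contra hlt
    exact hnp hloc ⟨0, by omega⟩ ⟨1, hm⟩ (by simp) r hr (by omega) a ha
  · rintro rfl
    exact ⟨_, hpart⟩
end
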